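/- Let L be a Lie algebra over a field F of characteristic p > 2 such that the universal enveloping algebra U(L) is Lie solvable (under [x,y] = xy − yx). Then L is abelian. -/

import Mathlib

/-- The Lie derived series of an associative algebra `A` over a field `F`:
`δ⁰(A) = A`, `δⁿ⁺¹(A) = span {xy - yx : x, y ∈ δⁿ(A)}`. -/
def lieDerivedSeries (F A : Type*) [Field F] [Ring A] [Algebra F A] : ℕ → Submodule F A
  | 0 => ⊤
  | n + 1 => Submodule.span F
      {z : A | ∃ x ∈ lieDerivedSeries F A n, ∃ y ∈ lieDerivedSeries F A n, z = x * y - y * x}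

section LieDerivedSeries

variable {F A B : Type*} [Field F] [Ring A] [Algebra F A] [Ring B] [Algebra F B]

theorem commutator_mem_lieDerivedSeries_succ {n : ℕ} {x y : A}
    (hx : x ∈ lieDerivedSeries F A n) (hy : y ∈ lieDerivedSeries F A n) :
    x * y - y * x ∈ lieDerivedSeries F A (n + 1) :=
  Submodule.subset_span ⟨x, hx, y, hy, rfl⟩

theorem lieDerivedSeries_le_map (f : A →ₐ[F] B) (hf : Function.Surjective f) (n : ℕ) :
    lieDerivedSeries F B n ≤ (lieDerivedSeries F A n).map f.toLinearMap := by
  induction n with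
  | zero =>
    intro b _
    obtain ⟨a, rfl⟩ := hf b
    exact ⟨a, Submodule.mem_top, rfl⟩
  | succ n ih =>
    refine Submodule.span_le.2 ?_
    rintro _ ⟨x, hx, y, hy, rfl⟩
    obtain ⟨a, ha, rfl⟩ := ih hx
    obtain ⟨b, hb, rfl⟩ := ih hy
    exact ⟨a * b - b * a, commutator_mem_lieDerivedSeries_succ ha hb, by simp⟩

theorem lieDerivedSeries_eq_bot_of_surjective (f : A →ₐ[F] B) (hf : Function.Surjective f) {n : ℕ}
    (h : lieDerivedSeries F A n = ⊥) : lieDerivedSeries F B n = ⊥ := by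
  have := lieDerivedSeries_le_map f hf n
  rwa [h, Submodule.map_bot, le_bot_iff] at this

/-- If `R` acts on the commutative ring `C` so that `X` normalises the image of `C`, then every
derived term contains a multiple of the Witt-type space `C X` by a power of `[X, u]`. -/
theorem exists_pow_mul_mem_lieDerivedSeries {C : Type*} [CommRing C] (h2 : (2 : F) ≠ 0)
    (φ : C →+* A) (X : A) (hX : ∀ b, ∃ c, X * φ b = φ b * X + φ c) {u w : C}
    (hw : X * φ u = φ u * X + φ w) (n : ℕ) :
    ∃ k : ℕ, ∀ b, φ (w ^ k * b) * X ∈ lieDerivedSeries F A n := by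
  have hmul : ∀ {f g f' g' : C}, X * φ f = φ f * X + φ f' → X * φ g = φ g * X + φ g' →
      X * φ (f * g) = φ (f * g) * X + φ (f * g' + f' * g) := by
    intro f g f' g' hf hg
    rw [map_mul, ← mul_assoc, hf, add_mul, mul_assoc, hg]
    simp only [map_add, map_mul]
    noncomm_ring
  have hbr : ∀ {f g f' g' : C}, X * φ f = φ f * X + φ f' → X * φ g = φ g * X + φ g' →
      (φ f * X) * (φ g * X) - (φ g * X) * (φ f * X) = φ (f * g' - g * f') * X := by
    intro f g f' g' hf hg
    have hfg : φ f * φ g = φ g * φ f := by rw [← map_mul, mul_comm, map_mul]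
    calc _ = φ f * (X * φ g) * X - φ g * (X * φ f) * X := by noncomm_ring
      _ = (φ f * φ g - φ g * φ f) * X * X + (φ f * φ g' - φ g * φ f') * X := by
        rw [hf, hg]; noncomm_ring
      _ = _ := by rw [hfg]; simp
  induction n with
  | zero => exact ⟨0, fun b => Submodule.mem_top⟩
  | succ n ih =>
    obtain ⟨k, hk⟩ := ih
    refine ⟨2 * k + 1, fun b => ?_⟩
    obtain ⟨b', hb⟩ := hX b
    obtain ⟨q, hq⟩ := hX (w ^ k)
    have h1 := commutator_mem_lieDerivedSeries_succ (hk b) (hk u)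
    have h3 := commutator_mem_lieDerivedSeries_succ (hk (u * b)) (hk 1)
    rw [hbr (hmul hq hb) (hmul hq hw)] at h1
    rw [mul_one, hbr (hmul hq (hmul hw hb)) hq] at h3
    have h4 := Submodule.smul_mem _ (2 : F)⁻¹ (Submodule.sub_mem _ h1 h3)
    convert h4 using 1
    rw [eq_inv_smul_iff₀ h2, ← sub_mul, ← map_sub, two_smul, ← add_mul, ← map_add]
    congr 2
    ring

theorem isNilpotent_of_lieDerivedSeries_eq_bot {C : Type*} [CommRing C] (h2 : (2 : F) ≠ 0)
    (φ : C →+* A) (X : A) (hX : ∀ b, ∃ c, X * φ b = φ b * X + φ c) {u w : C}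
    (hw : X * φ u = φ u * X + φ w) {n : ℕ} (h : lieDerivedSeries F A n = ⊥) :
    IsNilpotent (φ w) := by
  obtain ⟨k, hk⟩ := exists_pow_mul_mem_lieDerivedSeries h2 φ X hX hw n
  simp only [h, Submodule.mem_bot] at hk
  refine ⟨k + 1, ?_⟩
  have hu := hk u
  have h1 := hk 1
  rw [mul_one] at h1
  rw [← map_pow, pow_succ, map_mul]
  calc φ (w ^ k) * φ w = φ (w ^ k) * X * φ u - φ (w ^ k * u) * X := by
        rw [mul_assoc, hw, map_mul]; noncomm_ring
    _ = 0 := by rw [h1, hu]; simp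

end LieDerivedSeries

section LieAlgebra

open UniversalEnvelopingAlgebra

attribute [local instance] LieRing.ofAssociativeRing

variable {F L : Type*} [Field F] [LieRing L] [LieAlgebra F L]

theorem UniversalEnvelopingAlgebra.ι_lie (x y : L) :
    ι F ⁅x, y⁆ = ι F x * ι F y - ι F y * ι F x :=
  (ι F).map_lie x y

open scoped IsMulCommutative in
/-- If `S` is a commuting set stable under `ad x` and `U(L)` is Lie solvable, then `[x, a]` is
nilpotent in `U(L)` for every `a ∈ S`. -/
theorem isNilpotent_ι_lie {n : ℕ} (h2 : (2 : F) ≠ 0)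
    (h : lieDerivedSeries F (UniversalEnvelopingAlgebra F L) n = ⊥) (S : Set L) (x : L)
    (hS : ∀ a ∈ S, ∀ b ∈ S, ⁅a, b⁆ = 0) (hx : ∀ a ∈ S, ⁅x, a⁆ ∈ S) {a : L} (ha : a ∈ S) :
    IsNilpotent (ι F ⁅x, a⁆) := by
  have hcomm : ∀ u ∈ ι F '' S, ∀ v ∈ ι F '' S, u * v = v * u := by
    rintro _ ⟨u, hu, rfl⟩ _ ⟨v, hv, rfl⟩
    rw [← sub_eq_zero, ← ι_lie, hS u hu v hv, map_zero]
  have := Algebra.isMulCommutative_adjoin F hcomm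
  let φ : Algebra.adjoin F (ι F '' S) →+* UniversalEnvelopingAlgebra F L :=
    (Algebra.adjoin F (ι F '' S)).val.toRingHom
  have hmem : ∀ {b}, b ∈ S → ι F b ∈ Algebra.adjoin F (ι F '' S) := fun hb =>
    Algebra.subset_adjoin ⟨_, hb, rfl⟩
  have hlie : ∀ b, ι F x * ι F b = ι F b * ι F x + ι F ⁅x, b⁆ := fun b => by
    rw [ι_lie]; abel
  refine isNilpotent_of_lieDerivedSeries_eq_bot h2 φ (ι F x) ?_
    (u := ⟨ι F a, hmem ha⟩) (w := ⟨ι F ⁅x, a⁆, hmem (hx a ha)⟩) (hlie a) h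
  rintro ⟨b, hb⟩
  suffices ∃ c ∈ Algebra.adjoin F (ι F '' S), ι F x * b = b * ι F x + c by
    obtain ⟨c, hc, h⟩ := this
    exact ⟨⟨c, hc⟩, h⟩
  induction hb using Algebra.adjoin_induction with
  | mem _ hb =>
    obtain ⟨b, hb, rfl⟩ := hb
    exact ⟨_, hmem (hx b hb), hlie b⟩
  | algebraMap r => exact ⟨0, zero_mem _, by rw [Algebra.commutes, add_zero]⟩
  | add b c _ _ hb hc =>
    obtain ⟨b', hb', hb⟩ := hb
    obtain ⟨c', hc', hc⟩ := hc
    exact ⟨b' + c', add_mem hb' hc', by rw [mul_add, hb, hc]; noncomm_ring⟩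
  | mul b c hbS hcS hb hc =>
    obtain ⟨b', hb', hb⟩ := hb
    obtain ⟨c', hc', hc⟩ := hc
    refine ⟨b * c' + b' * c, add_mem (mul_mem hbS hc') (mul_mem hb' hcS), ?_⟩
    rw [← mul_assoc, hb, add_mul, mul_assoc, hc]
    noncomm_ring

/-- The representation of `L` on the symmetric algebra of `V` in which `x` acts as multiplication by
`t x` plus the derivation extending `T x` detects non-nilpotency of elements of `U(L)`. -/
theorem eq_zero_of_isNilpotent_ι {V : Type*} [AddCommGroup V] [Module F V]
    (T : L →ₗ[F] Module.End F V) (t : L →ₗ[F] V)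
    (hT : ∀ x y v, T ⁅x, y⁆ v = T x (T y v) - T y (T x v))
    (ht : ∀ x y, t ⁅x, y⁆ = T x (t y) - T y (t x)) {b : L} (hb : T b (t b) = 0)
    (hnil : IsNilpotent (ι F b)) : t b = 0 := by
  let B := Module.Basis.ofVectorSpace F V
  let P := MvPolynomial (Module.Basis.ofVectorSpaceIndex F V) F
  let e : V →ₗ[F] P := B.constr F MvPolynomial.X
  let D : L →ₗ[F] Derivation F P P :=
    (MvPolynomial.mkDerivationEquiv F).toLinearMap ∘ₗ
      { toFun := fun x i => e (T x (B i))
        map_add' := fun x y => by ext; simp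
        map_smul' := fun r x => by ext; simp }
  have hDX : ∀ x i, D x (MvPolynomial.X i) = e (T x (B i)) := fun x i =>
    MvPolynomial.mkDerivation_X F _ i
  have heB : ∀ i, e (B i) = MvPolynomial.X i := fun i => B.constr_basis F _ i
  have hDe : ∀ x v, D x (e v) = e (T x v) := fun x v => by
    have : (D x).toLinearMap ∘ₗ e = e ∘ₗ T x := B.ext fun i => by simp [heB, hDX]
    exact LinearMap.congr_fun this v
  have hDlie : ∀ x y f, D ⁅x, y⁆ f = D x (D y f) - D y (D x f) := fun x y f => by
    have : D ⁅x, y⁆ = ⁅D x, D y⁆ := MvPolynomial.derivation_ext fun i => by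
      rw [Derivation.commutator_apply, hDX, hDX, hDX, hDe, hDe, hT, map_sub]
    rw [this, Derivation.commutator_apply]
  let ρ : L →ₗ⁅F⁆ Module.End F P :=
    { LinearMap.mul F P ∘ₗ e ∘ₗ t +
        { toFun := fun x => (D x).toLinearMap
          map_add' := fun x y => by ext; simp
          map_smul' := fun r x => by ext; simp } with
      map_lie' := fun {x y} => by
        refine LinearMap.ext fun f => ?_
        simp [hDlie, hDe, ht, Ring.lie_def]
        ring }
  have hρ : ∀ f, ρ b f = e (t b) * f + D b f := fun f => rfl
  have hpow : ∀ n : ℕ, (ρ b ^ n) 1 = e (t b) ^ n := by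
    intro n
    induction n with
    | zero => simp
    | succ n ih =>
      rw [pow_succ', Module.End.mul_apply, ih, hρ, Derivation.leibniz_pow, hDe, hb]
      simp [pow_succ']
  obtain ⟨n, hn⟩ := hnil
  have h0 : ρ b ^ n = 0 := by
    rw [← UniversalEnvelopingAlgebra.lift_ι_apply F ρ b, ← map_pow, hn, map_zero]
  have he0 : e (t b) = 0 := eq_zero_of_pow_eq_zero (n := n) (by rw [← hpow, h0]; rfl)
  have hinj : Function.Injective e :=
    Module.Basis.injective_constr_of_linearIndependent B (MvPolynomial.linearIndependent_X _ _)
  exact hinj (by rw [he0, map_zero])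

theorem lie_lie_eq_zero_of_abelian_of_stable {n : ℕ} (h2 : (2 : F) ≠ 0)
    (h : lieDerivedSeries F (UniversalEnvelopingAlgebra F L) n = ⊥) (S : Set L)
    (hS : ∀ a ∈ S, ∀ b ∈ S, ⁅a, b⁆ = 0) (hL : ∀ y : L, ∀ a ∈ S, ⁅y, a⁆ ∈ S)
    (x y : L) {a : L} (ha : a ∈ S) : ⁅x, ⁅y, a⁆⁆ = 0 := by
  have hya := hL y a ha
  exact eq_zero_of_isNilpotent_ι (LieAlgebra.ad F L : L →ₗ[F] Module.End F L)
    (LieAlgebra.ad F L x) (fun u v w => by simp)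
    (fun u v => by
      simp only [LieHom.coe_toLinearMap, LieAlgebra.ad_apply]
      rw [leibniz_lie x u v, ← lie_skew ⁅x, u⁆ v]
      abel)
    (hS _ hya _ (hL x _ hya)) (isNilpotent_ι_lie h2 h S y hS (hL y) ha)

theorem lie_eq_zero_of_nilpotency_class_two {n : ℕ} (h2 : (2 : F) ≠ 0)
    (h : lieDerivedSeries F (UniversalEnvelopingAlgebra F L) n = ⊥)
    (hL : ∀ x y z : L, ⁅x, ⁅y, z⁆⁆ = 0) (x y : L) : ⁅x, y⁆ = 0 := by
  have hL' : ∀ x y z : L, ⁅⁅x, y⁆, z⁆ = 0 := fun x y z => by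
    rw [← lie_skew, hL, neg_zero]
  have hnil : IsNilpotent (ι F ⁅x, y⁆) := by
    refine isNilpotent_ι_lie h2 h {y, ⁅x, y⁆, 0} x ?_ ?_ (by simp)
    · rintro a (rfl | rfl | rfl) b (rfl | rfl | rfl) <;> simp [hL, hL']
    · rintro a (rfl | rfl | rfl) <;> simp [hL]
  refine eq_zero_of_isNilpotent_ι ((2 : F)⁻¹ • (LieAlgebra.ad F L : L →ₗ[F] Module.End F L))
    LinearMap.id (fun u v w => by simp [hL]) (fun u v => ?_) (by simp) hnil
  have : ⁅v, u⁆ = -⁅u, v⁆ := (lie_skew v u).symm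
  simp only [LinearMap.id_apply, LinearMap.smul_apply, LieHom.coe_toLinearMap,
    LieAlgebra.ad_apply, this]
  rw [← smul_sub, sub_neg_eq_add, ← two_smul F, inv_smul_smul₀ h2]

theorem ι_mem_lieDerivedSeries (n : ℕ) {x : L} (hx : x ∈ LieAlgebra.derivedSeries F L n) :
    ι F x ∈ lieDerivedSeries F (UniversalEnvelopingAlgebra F L) n := by
  induction n generalizing x with
  | zero => exact Submodule.mem_top
  | succ n ih =>
    rw [LieAlgebra.derivedSeries_def, LieAlgebra.derivedSeriesOfIdeal_succ,
      ← LieSubmodule.mem_toSubmodule, LieSubmodule.lieIdeal_oper_eq_linear_span'] at hx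
    refine Submodule.span_le (p := (lieDerivedSeries F (UniversalEnvelopingAlgebra F L)
      (n + 1)).comap (ι F (L := L)).toLinearMap).2 ?_ hx
    rintro _ ⟨a, ha, b, hb, rfl⟩
    change ι F ⁅a, b⁆ ∈ lieDerivedSeries F (UniversalEnvelopingAlgebra F L) (n + 1)
    rw [ι_lie]
    exact commutator_mem_lieDerivedSeries_succ (ih ha) (ih hb)

theorem derivedSeries_succ_eq_bot_of_lieDerivedSeries_eq_bot {n : ℕ}
    (h : lieDerivedSeries F (UniversalEnvelopingAlgebra F L) n = ⊥) :
    LieAlgebra.derivedSeries F L (n + 1) = ⊥ := by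
  rw [LieAlgebra.derivedSeries_def, LieAlgebra.derivedSeriesOfIdeal_succ,
    LieSubmodule.lie_eq_bot_iff]
  intro x hx y _
  have hι : ι F x = 0 := by
    have := ι_mem_lieDerivedSeries n hx
    rwa [h] at this
  have had : LieAlgebra.ad F L x = 0 := by
    rw [← lift_ι_apply F (LieAlgebra.ad F L) x, hι, map_zero]
  exact LinearMap.congr_fun had y

theorem lieDerivedSeries_quotient_eq_bot {n : ℕ}
    (h : lieDerivedSeries F (UniversalEnvelopingAlgebra F L) n = ⊥) (I : LieIdeal F L) :
    lieDerivedSeries F (UniversalEnvelopingAlgebra F (L ⧸ I)) n = ⊥ := by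
  let q : L →ₗ⁅F⁆ L ⧸ I :=
    { (LieSubmodule.Quotient.mk' I : L →ₗ[F] L ⧸ I) with
      map_lie' := fun {x y} => LieSubmodule.Quotient.mk_bracket I x y }
  let f := lift F ((ι F).comp q)
  have hf : ∀ x, ι F (q x) ∈ f.range := fun x => ⟨ι F x, lift_ι_apply F _ x⟩
  refine lieDerivedSeries_eq_bot_of_surjective f ?_ h
  let g : L ⧸ I →ₗ⁅F⁆ f.range :=
    { LinearMap.codRestrict f.range.toSubmodule (ι F (L := L ⧸ I)).toLinearMap (fun x => by
        obtain ⟨x, rfl⟩ := LieSubmodule.Quotient.surjective_mk' I x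
        exact hf x) with
      map_lie' := fun {x y} => Subtype.ext (ι_lie (F := F) x y) }
  have hg : f.range.val.comp (lift F g) = AlgHom.id F _ := by
    refine hom_ext F (LieHom.ext fun x => ?_)
    change ((lift F g (ι F x) : f.range) : UniversalEnvelopingAlgebra F (L ⧸ I)) = ι F x
    rw [lift_ι_apply]
    rfl
  intro b
  rw [← AlgHom.mem_range, ← AlgHom.id_apply (R := F) b, ← hg]
  exact (lift F g b).2

end LieAlgebra

/-- if `L` is a Lie algebra over a field of characteristic `p > 2` whose
universal enveloping algebra `U(L)` is Lie solvable, then `L` is abelian. -/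
theorem abelian_of_lieSolvable_enveloping (p : ℕ) (F L : Type*) [Field F] [CharP F p]
    (hp : 2 < p) [LieRing L] [LieAlgebra F L]
    (h : ∃ n : ℕ, lieDerivedSeries F (UniversalEnvelopingAlgebra F L) n = ⊥) :
    ∀ x y : L, ⁅x, y⁆ = 0 := by
  obtain ⟨n, h⟩ := h
  have h2 : (2 : F) ≠ 0 := by
    have := (CharP.cast_eq_zero_iff F p 2).not.2 fun hd => by
      have := Nat.le_of_dvd two_pos hd
      omega
    exact_mod_cast this
  let D : ℕ → LieIdeal F L := LieAlgebra.derivedSeries F L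
  have hD : ∀ k, D (k + 1) = ⁅D k, D k⁆ := LieAlgebra.derivedSeriesOfIdeal_succ F L ⊤
  have hmem : ∀ x y : L, ⁅x, y⁆ ∈ D 1 := fun x y => by
    rw [hD 0]
    exact LieSubmodule.lie_mem_lie (LieSubmodule.mem_top x) (LieSubmodule.mem_top y)
  have h12 : D 1 ≤ ⁅(⊤ : LieIdeal F L), D 1⁆ := by
    set I := ⁅(⊤ : LieIdeal F L), D 1⁆
    rw [hD 0, LieSubmodule.lie_le_iff]
    intro x _ y _
    rw [← LieSubmodule.Quotient.mk_eq_zero', LieSubmodule.Quotient.mk_bracket]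
    refine lie_eq_zero_of_nilpotency_class_two h2 (lieDerivedSeries_quotient_eq_bot h I) ?_ _ _
    intro x y z
    obtain ⟨x, rfl⟩ := LieSubmodule.Quotient.surjective_mk' I x
    obtain ⟨y, rfl⟩ := LieSubmodule.Quotient.surjective_mk' I y
    obtain ⟨z, rfl⟩ := LieSubmodule.Quotient.surjective_mk' I z
    refine (LieSubmodule.Quotient.mk_eq_zero' (N := I) (m := ⁅x, ⁅y, z⁆⁆)).2 ?_
    exact LieSubmodule.lie_mem_lie (LieSubmodule.mem_top x) (hmem y z)
  have h23 : ⁅(⊤ : LieIdeal F L), ⁅(⊤ : LieIdeal F L), D 1⁆⁆ ≤ D 2 := by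
    rw [LieSubmodule.lie_le_iff]
    intro x _ m hm
    rw [← LieSubmodule.mem_toSubmodule, LieSubmodule.lieIdeal_oper_eq_linear_span'] at hm
    refine Submodule.span_le (p := (D 2).toSubmodule.comap (LieAlgebra.ad F L x)).2 ?_ hm
    rintro _ ⟨y, -, a, ha, rfl⟩
    change ⁅x, ⁅y, a⁆⁆ ∈ D 2
    rw [← LieSubmodule.Quotient.mk_eq_zero', LieSubmodule.Quotient.mk_bracket,
      LieSubmodule.Quotient.mk_bracket]
    refine lie_lie_eq_zero_of_abelian_of_stable h2 (lieDerivedSeries_quotient_eq_bot h (D 2))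
      (LieSubmodule.Quotient.mk '' (D 1 : Set L)) ?_ ?_ _ _ ⟨a, ha, rfl⟩
    · rintro _ ⟨a, ha, rfl⟩ _ ⟨b, hb, rfl⟩
      rw [← LieSubmodule.Quotient.mk_bracket, LieSubmodule.Quotient.mk_eq_zero', hD 1]
      exact LieSubmodule.lie_mem_lie ha hb
    · rintro y _ ⟨a, ha, rfl⟩
      obtain ⟨y, rfl⟩ := LieSubmodule.Quotient.surjective_mk' (D 2) y
      exact ⟨⁅y, a⁆, (D 1).lie_mem ha, LieSubmodule.Quotient.mk_bracket _ y a⟩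
  have hperf : D 1 ≤ D 2 := h12.trans ((LieSubmodule.mono_lie_right _ h12).trans h23)
  have hle : ∀ k, D 1 ≤ D (k + 1) := fun k => by
    induction k with
    | zero => exact le_rfl
    | succ k ih =>
      refine hperf.trans ?_
      rw [hD (k + 1), hD 1]
      exact LieSubmodule.mono_lie ih ih
  have hbot : D 1 ≤ ⊥ := (hle n).trans (derivedSeries_succ_eq_bot_of_lieDerivedSeries_eq_bot h).le
  intro x y
  exact (LieSubmodule.mem_bot _).1 (hbot (hmem x y))
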